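/- Let φ be a smooth solution of the sine-Gordon equation on ℝ² and let U : ℝ²×(0,∞) → M₂(ℂ) be smooth and satisfy the Lax system in (x,y) for each λ > 0, with U(0,0,λ) = I and U(x,y,λ) ∈ SU(2). Define ψ := λ·(∂_λU)·U⁻¹ and N := U·((i/2)σ₃)·U⁻¹. Then for all (x,y) and λ > 0: ⟨∂ₓ∂ₓψ, N⟩ = 0 and ⟨∂_y∂_yψ, N⟩ = 0 (the coordinate lines are asymptotic lines), and ⟨∂ₓ∂ₓψ,N⟩·⟨∂_y∂_yψ,N⟩ − ⟨∂_y∂ₓψ,N⟩² = −(⟨∂ₓψ,∂ₓψ⟩·⟨∂_yψ,∂_yψ⟩ − ⟨∂ₓψ,∂_yψ⟩²); i.e., the determinant of the second fundamental form equals minus the determinant of the first fundamental form, so the Gaussian curvature of the Sym immersion equals −1 wherever sin φ ≠ 0. -/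

import Mathlib

open Matrix Complex

attribute [local instance] Matrix.normedAddCommGroup Matrix.normedSpace

noncomputable section

/-- The Pauli matrix σ₃. -/
def sigma3 : Matrix (Fin 2) (Fin 2) ℂ := !![1, 0; 0, -1]

/-- The matrix `A_φ(x,y,λ) = (i/2)·[[∂ₓφ, −λ], [−λ, −∂ₓφ]]` of the Lax system. -/
def Aphi (φ : ℝ → ℝ → ℝ) (lam : ℂ) (x y : ℝ) : Matrix (Fin 2) (Fin 2) ℂ :=
  (Complex.I / 2) •
    !![((deriv (fun x' => φ x' y) x : ℝ) : ℂ), -lam;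
       -lam, -((deriv (fun x' => φ x' y) x : ℝ) : ℂ)]

/-- The matrix `B_φ(x,y,λ) = (i/2)·λ⁻¹·[[0, e^{−iφ}], [e^{iφ}, 0]]` of the Lax system. -/
def Bphi (φ : ℝ → ℝ → ℝ) (lam : ℂ) (x y : ℝ) : Matrix (Fin 2) (Fin 2) ℂ :=
  (Complex.I / 2) • lam⁻¹ •
    !![0, Complex.exp (-Complex.I * ((φ x y : ℝ) : ℂ));
       Complex.exp (Complex.I * ((φ x y : ℝ) : ℂ)), 0]

/-- Membership in SU(2): unitary with determinant one. -/
def IsSU2 (g : Matrix (Fin 2) (Fin 2) ℂ) : Prop := g * gᴴ = 1 ∧ g.det = 1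

/-- The bilinear pairing `⟨X,Y⟩ = −2·tr(X·Y)` on 2×2 complex matrices. -/
def pairing (X Y : Matrix (Fin 2) (Fin 2) ℂ) : ℂ := -2 * (X * Y).trace

/-- The Sym formula: `ψ(x,y,λ) = λ·(∂_λU)·U⁻¹`. -/
def symMap (U : ℝ → ℝ → ℝ → Matrix (Fin 2) (Fin 2) ℂ) (x y lam : ℝ) :
    Matrix (Fin 2) (Fin 2) ℂ :=
  (lam : ℂ) • (deriv (fun l : ℝ => U x y l) lam * (U x y lam)⁻¹)

/-- The extended frame hypotheses: `U` is smooth on `ℝ² × (0,∞)`, solves the Lax system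
of `φ` for each `λ > 0`, satisfies `U(0,0,λ) = I`, and takes values in SU(2). -/
def IsExtendedFrame (φ : ℝ → ℝ → ℝ) (U : ℝ → ℝ → ℝ → Matrix (Fin 2) (Fin 2) ℂ) : Prop :=
  ContDiffOn ℝ (⊤ : ℕ∞) (fun p : ℝ × ℝ × ℝ => U p.1 p.2.1 p.2.2)
    (Set.univ ×ˢ Set.univ ×ˢ Set.Ioi 0) ∧
  (∀ lam : ℝ, 0 < lam → ∀ x y : ℝ,
    HasDerivAt (fun x' => U x' y lam) (U x y lam * Aphi φ (lam : ℂ) x y) x ∧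
    HasDerivAt (fun y' => U x y' lam) (U x y lam * Bphi φ (lam : ℂ) x y) y) ∧
  (∀ lam : ℝ, 0 < lam → U 0 0 lam = 1) ∧
  (∀ x y lam : ℝ, 0 < lam → IsSU2 (U x y lam))

/-- The Gauss map `N = U·((i/2)σ₃)·U⁻¹` of the Sym immersion. -/
def gaussN (U : ℝ → ℝ → ℝ → Matrix (Fin 2) (Fin 2) ℂ) (x y lam : ℝ) :
    Matrix (Fin 2) (Fin 2) ℂ :=
  U x y lam * ((Complex.I / 2) • sigma3) * (U x y lam)⁻¹

theorem hasDerivAt_deriv_swap {E : Type*} [NormedAddCommGroup E] [NormedSpace ℝ E]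
    {f : ℝ × ℝ → E} {s t : ℝ} (hf : ContDiffAt ℝ 2 f (s, t)) {g : ℝ → E} {G : E}
    (hg : ∀ᶠ l in nhds t, HasDerivAt (fun x => f (x, l)) (g l) s) (hG : HasDerivAt g G t) :
    HasDerivAt (fun x => deriv (fun l => f (x, l)) t) G s := by
  have hd : ∀ᶠ p in nhds (s, t), DifferentiableAt ℝ f p :=
    (hf.eventually (by simp)).mono fun p hp => hp.differentiableAt (by simp)
  have hd2 : HasFDerivAt (fderiv ℝ f) (fderiv ℝ (fderiv ℝ f) (s, t)) (s, t) :=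
    ((hf.fderiv_right (m := 1) (by norm_num)).differentiableAt (by simp)).hasFDerivAt
  have hfst : ∀ x l : ℝ, HasDerivAt (fun x => (x, l)) ((1 : ℝ), (0 : ℝ)) x := fun x l =>
    (hasDerivAt_id x).prodMk (hasDerivAt_const x l)
  have hsnd : ∀ x l : ℝ, HasDerivAt (fun l => (x, l)) ((0 : ℝ), (1 : ℝ)) l := fun x l =>
    (hasDerivAt_const l x).prodMk (hasDerivAt_id l)
  have hsymm := hf.isSymmSndFDerivAt (by simp)
  have e1 : (fun x => deriv (fun l => f (x, l)) t) =ᶠ[nhds s]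
      fun x => fderiv ℝ f (x, t) (0, 1) := by
    filter_upwards [(hfst s t).continuousAt.eventually hd] with x hx
    exact (hx.hasFDerivAt.comp_hasDerivAt t (hsnd x t)).deriv
  have e2 : g =ᶠ[nhds t] fun l => fderiv ℝ f (s, l) (1, 0) := by
    filter_upwards [(hsnd s t).continuousAt.eventually hd, hg] with l hl hgl
    exact hgl.unique (hl.hasFDerivAt.comp_hasDerivAt s (hfst s l))
  have h1 : HasDerivAt (fun x => fderiv ℝ f (x, t) (0, 1))
      (fderiv ℝ (fderiv ℝ f) (s, t) (1, 0) (0, 1)) s := by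
    exact (ContinuousLinearMap.apply ℝ E ((0 : ℝ), (1 : ℝ))).hasFDerivAt.comp_hasDerivAt s
      (hd2.comp_hasDerivAt s (hfst s t))
  have h2 : HasDerivAt (fun l => fderiv ℝ f (s, l) (1, 0))
      (fderiv ℝ (fderiv ℝ f) (s, t) (0, 1) (1, 0)) t := by
    exact (ContinuousLinearMap.apply ℝ E ((1 : ℝ), (0 : ℝ))).hasFDerivAt.comp_hasDerivAt t
      (hd2.comp_hasDerivAt t (hsnd s t))
  rw [hG.unique (h2.congr_of_eventuallyEq e2), hsymm.eq]
  exact h1.congr_of_eventuallyEq e1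

theorem hasDerivAt_matrix_iff {m n : Type*} [Fintype m] [Fintype n]
    {M : ℝ → Matrix m n ℂ} {M' : Matrix m n ℂ} {t : ℝ} :
    HasDerivAt M M' t ↔ ∀ i j, HasDerivAt (fun s => M s i j) (M' i j) t := by
  refine Iff.trans (hasDerivAt_pi (E' := fun _ : m => n → ℂ)) (forall_congr' fun i => ?_)
  exact hasDerivAt_pi (E' := fun _ : n => ℂ)

theorem HasDerivAt.matrixMul {l m n : Type*} [Fintype l] [Fintype m] [Fintype n]
    {M : ℝ → Matrix l m ℂ} {M' : Matrix l m ℂ} {P : ℝ → Matrix m n ℂ} {P' : Matrix m n ℂ} {t : ℝ}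
    (hM : HasDerivAt M M' t) (hP : HasDerivAt P P' t) :
    HasDerivAt (fun s => M s * P s) (M' * P t + M t * P') t := by
  rw [hasDerivAt_matrix_iff] at hM hP ⊢
  intro i j
  simp only [Matrix.add_apply, Matrix.mul_apply, ← Finset.sum_add_distrib]
  exact HasDerivAt.fun_sum fun k _ => (hM i k).mul (hP k j)

theorem HasDerivAt.matrixAdjugate_fin_two {M : ℝ → Matrix (Fin 2) (Fin 2) ℂ}
    {M' : Matrix (Fin 2) (Fin 2) ℂ} {t : ℝ} (hM : HasDerivAt M M' t) :
    HasDerivAt (fun s => (M s).adjugate) M'.adjugate t := by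
  rw [hasDerivAt_matrix_iff] at hM ⊢
  simp only [Matrix.adjugate_fin_two]
  intro i j
  fin_cases i <;> fin_cases j
  · exact hM 1 1
  · exact (hM 0 1).neg
  · exact (hM 1 0).neg
  · exact hM 0 0

theorem Matrix.adjugate_eq_neg_of_trace_eq_zero {M : Matrix (Fin 2) (Fin 2) ℂ}
    (hM : M.trace = 0) : M.adjugate = -M := by
  rw [Matrix.trace_fin_two] at hM
  rw [Matrix.adjugate_fin_two]
  ext i j
  fin_cases i <;> fin_cases j <;> simp <;> linear_combination hM

theorem Matrix.inv_eq_adjugate_of_det_eq_one {M : Matrix (Fin 2) (Fin 2) ℂ}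
    (hM : M.det = 1) : M⁻¹ = M.adjugate := by
  simp [Matrix.inv_def, hM]

theorem HasDerivAt.matrixInv_of_trace_eq_zero {F : ℝ → Matrix (Fin 2) (Fin 2) ℂ}
    {M : Matrix (Fin 2) (Fin 2) ℂ} {t : ℝ} (hdet : ∀ s, (F s).det = 1)
    (hF : HasDerivAt F (F t * M) t) (hM : M.trace = 0) :
    HasDerivAt (fun s => (F s)⁻¹) (-(M * (F t)⁻¹)) t := by
  simp only [Matrix.inv_eq_adjugate_of_det_eq_one (hdet _)]
  convert hF.matrixAdjugate_fin_two using 1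
  rw [Matrix.adjugate_mul_distrib, Matrix.adjugate_eq_neg_of_trace_eq_zero hM, neg_mul]

theorem HasDerivAt.matrixConj {F : ℝ → Matrix (Fin 2) (Fin 2) ℂ}
    {M : Matrix (Fin 2) (Fin 2) ℂ} {t : ℝ} (hdet : ∀ s, (F s).det = 1)
    (hF : HasDerivAt F (F t * M) t) (hM : M.trace = 0)
    {K : ℝ → Matrix (Fin 2) (Fin 2) ℂ} {K' : Matrix (Fin 2) (Fin 2) ℂ} (hK : HasDerivAt K K' t) :
    HasDerivAt (fun s => F s * K s * (F s)⁻¹)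
      (F t * (M * K t - K t * M + K') * (F t)⁻¹) t := by
  convert (hF.matrixMul hK).matrixMul (hF.matrixInv_of_trace_eq_zero hdet hM) using 1
  noncomm_ring

theorem pairing_conj {g : Matrix (Fin 2) (Fin 2) ℂ} (hg : g.det = 1)
    (X Y : Matrix (Fin 2) (Fin 2) ℂ) :
    pairing (g * X * g⁻¹) (g * Y * g⁻¹) = pairing X Y := by
  have hu : IsUnit g.det := by simp [hg]
  have h : g * X * g⁻¹ * (g * Y * g⁻¹) = g * (X * Y) * g⁻¹ := by
    simp only [mul_assoc, Matrix.nonsing_inv_mul_cancel_left _ _ hu]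
  rw [pairing, pairing, h, Matrix.trace_mul_comm, Matrix.nonsing_inv_mul_cancel_left _ _ hu]

theorem trace_Aphi (φ : ℝ → ℝ → ℝ) (l : ℂ) (x y : ℝ) : (Aphi φ l x y).trace = 0 := by
  simp [Aphi, Matrix.trace_fin_two]

theorem trace_Bphi (φ : ℝ → ℝ → ℝ) (l : ℂ) (x y : ℝ) : (Bphi φ l x y).trace = 0 := by
  simp [Bphi, Matrix.trace_fin_two]

/-- The derivative of `Aphi` in the spectral parameter. -/
def AphiDeriv : Matrix (Fin 2) (Fin 2) ℂ := (Complex.I / 2) • !![0, -1; -1, 0]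

theorem hasDerivAt_Aphi (φ : ℝ → ℝ → ℝ) (x y lam : ℝ) :
    HasDerivAt (fun l : ℝ => Aphi φ (l : ℂ) x y) AphiDeriv lam := by
  have h : HasDerivAt (fun l : ℝ => (l : ℂ)) 1 lam := Complex.ofRealCLM.hasDerivAt
  rw [hasDerivAt_matrix_iff]
  intro i j
  fin_cases i <;> fin_cases j <;> simp only [Aphi, AphiDeriv, Matrix.smul_apply, smul_eq_mul]
  · simpa using hasDerivAt_const lam _
  · simpa using h.neg.const_mul (Complex.I / 2)
  · simpa using h.neg.const_mul (Complex.I / 2)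
  · simpa using hasDerivAt_const lam _

theorem hasDerivAt_Bphi (φ : ℝ → ℝ → ℝ) (x y : ℝ) {lam : ℝ} (hl : lam ≠ 0) :
    HasDerivAt (fun l : ℝ => Bphi φ (l : ℂ) x y) (-(lam : ℂ)⁻¹ • Bphi φ lam x y) lam := by
  have hl' : (lam : ℂ) ≠ 0 := by exact_mod_cast hl
  have h : HasDerivAt (fun l : ℝ => (l : ℂ)⁻¹) (-((lam : ℂ) ^ 2)⁻¹) lam :=
    (hasDerivAt_inv hl').comp_ofReal
  rw [hasDerivAt_matrix_iff]
  intro i j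
  refine ((h.mul_const (Complex.I / 2 * !![0, Complex.exp (-Complex.I * ((φ x y : ℝ) : ℂ));
    Complex.exp (Complex.I * ((φ x y : ℝ) : ℂ)), 0] i j)).congr_of_eventuallyEq
    (.of_forall fun l => ?_)).congr_deriv ?_
  · simp only [Bphi, Matrix.smul_apply, smul_eq_mul]
    ring
  · simp only [Bphi, Matrix.smul_apply, smul_eq_mul]
    ring

theorem hasDerivAt_Bphi_snd {φ : ℝ → ℝ → ℝ} {x y d : ℝ} (l : ℂ)
    (hφ : HasDerivAt (fun y => φ x y) d y) :
    HasDerivAt (fun y => Bphi φ l x y)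
      ((Complex.I / 2) • l⁻¹ •
        !![0, Complex.exp (-Complex.I * ((φ x y : ℝ) : ℂ)) * (-Complex.I * d);
          Complex.exp (Complex.I * ((φ x y : ℝ) : ℂ)) * (Complex.I * d), 0]) y := by
  have hc : HasDerivAt (fun y => ((φ x y : ℝ) : ℂ)) (d : ℂ) y := hφ.ofReal_comp
  rw [hasDerivAt_matrix_iff]
  intro i j
  fin_cases i <;> fin_cases j <;> simp only [Bphi, Matrix.smul_apply, smul_eq_mul]
  · simpa using hasDerivAt_const y (0 : ℂ)
  · exact (((hc.const_mul (-Complex.I)).cexp).const_mul l⁻¹).const_mul (Complex.I / 2)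
  · exact (((hc.const_mul Complex.I).cexp).const_mul l⁻¹).const_mul (Complex.I / 2)
  · simpa using hasDerivAt_const y (0 : ℂ)

/-- Along a one-parameter family of solutions of `∂ₛF = F·M`, the logarithmic derivative
`(∂_λF)·F⁻¹` has derivative `F·(∂_λM)·F⁻¹`. -/
theorem hasDerivAt_deriv_mul_inv {F : ℝ → ℝ → Matrix (Fin 2) (Fin 2) ℂ}
    {M : ℝ → Matrix (Fin 2) (Fin 2) ℂ} {M' : Matrix (Fin 2) (Fin 2) ℂ} {s t : ℝ}
    (hF : ContDiffAt ℝ 2 (fun p : ℝ × ℝ => F p.1 p.2) (s, t))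
    (hdet : ∀ s, (F s t).det = 1)
    (hd : ∀ᶠ l in nhds t, HasDerivAt (fun s => F s l) (F s l * M l) s)
    (hM : HasDerivAt M M' t) (htr : (M t).trace = 0) :
    HasDerivAt (fun s => deriv (fun l => F s l) t * (F s t)⁻¹) (F s t * M' * (F s t)⁻¹) s := by
  have hl : HasDerivAt (fun l => F s l) (deriv (fun l => F s l) t) t :=
    DifferentiableAt.hasDerivAt <| (hF.differentiableAt (by simp)).comp t
      (DifferentiableAt.prodMk (differentiableAt_const s) differentiableAt_id)
  have h : HasDerivAt (fun s => deriv (fun l => F s l) t)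
      (deriv (fun l => F s l) t * M t + F s t * M') s :=
    hasDerivAt_deriv_swap hF hd (hl.matrixMul hM)
  convert h.matrixMul (hd.self_of_nhds.matrixInv_of_trace_eq_zero hdet htr) using 1
  noncomm_ring

theorem IsExtendedFrame.contDiffAt {φ : ℝ → ℝ → ℝ} {U : ℝ → ℝ → ℝ → Matrix (Fin 2) (Fin 2) ℂ}
    (hU : IsExtendedFrame φ U) (x y : ℝ) {lam : ℝ} (hl : 0 < lam) :
    ContDiffAt ℝ 2 (fun p : ℝ × ℝ × ℝ => U p.1 p.2.1 p.2.2) (x, y, lam) := by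
  have hopen : IsOpen ((Set.univ : Set ℝ) ×ˢ (Set.univ : Set ℝ) ×ˢ Set.Ioi (0 : ℝ)) :=
    isOpen_univ.prod (isOpen_univ.prod isOpen_Ioi)
  exact (hU.1.contDiffAt (hopen.mem_nhds (by simpa using hl))).of_le (WithTop.coe_le_coe.2 (le_top : (2 : ℕ∞) ≤ ⊤))

theorem hasDerivAt_symMap_fst {φ : ℝ → ℝ → ℝ} {U : ℝ → ℝ → ℝ → Matrix (Fin 2) (Fin 2) ℂ}
    (hU : IsExtendedFrame φ U) (x y : ℝ) {lam : ℝ} (hl : 0 < lam) :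
    HasDerivAt (fun x => symMap U x y lam)
      ((lam : ℂ) • (U x y lam * AphiDeriv * (U x y lam)⁻¹)) x := by
  have hc : ContDiffAt ℝ 2 (fun p : ℝ × ℝ => U p.1 y p.2) (x, lam) :=
    (hU.contDiffAt x y hl).comp (x, lam)
      (contDiffAt_fst.prodMk (contDiffAt_const.prodMk contDiffAt_snd))
  refine HasDerivAt.fun_const_smul (lam : ℂ) (hasDerivAt_deriv_mul_inv
    (F := fun x l => U x y l) hc (fun x => (hU.2.2.2 x y lam hl).2)
    ?_ (hasDerivAt_Aphi φ x y lam) (trace_Aphi φ lam x y))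
  filter_upwards [lt_mem_nhds hl] with l hl'
  exact (hU.2.1 l hl' x y).1

theorem hasDerivAt_symMap_snd {φ : ℝ → ℝ → ℝ} {U : ℝ → ℝ → ℝ → Matrix (Fin 2) (Fin 2) ℂ}
    (hU : IsExtendedFrame φ U) (x y : ℝ) {lam : ℝ} (hl : 0 < lam) :
    HasDerivAt (fun y => symMap U x y lam)
      (-(U x y lam * Bphi φ lam x y * (U x y lam)⁻¹)) y := by
  have hc : ContDiffAt ℝ 2 (fun p : ℝ × ℝ => U x p.1 p.2) (y, lam) :=
    (hU.contDiffAt x y hl).comp (y, lam)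
      (contDiffAt_const.prodMk (contDiffAt_fst.prodMk contDiffAt_snd))
  have h := HasDerivAt.fun_const_smul (lam : ℂ) (hasDerivAt_deriv_mul_inv
    (F := fun y l => U x y l) hc (fun y => (hU.2.2.2 x y lam hl).2)
    (by
      filter_upwards [lt_mem_nhds hl] with l hl'
      exact (hU.2.1 l hl' x y).2) (hasDerivAt_Bphi φ x y hl.ne') (trace_Bphi φ lam x y))
  have hl' : (lam : ℂ) ≠ 0 := by exact_mod_cast hl.ne'
  refine h.congr_deriv ?_
  simp [smul_smul, hl']

theorem pairing_smul_left (c : ℂ) (X Y : Matrix (Fin 2) (Fin 2) ℂ) :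
    pairing (c • X) Y = c * pairing X Y := by
  simp only [pairing, Matrix.smul_mul, Matrix.trace_smul, smul_eq_mul]
  ring

theorem pairing_smul_right (c : ℂ) (X Y : Matrix (Fin 2) (Fin 2) ℂ) :
    pairing X (c • Y) = c * pairing X Y := by
  simp only [pairing, Matrix.mul_smul, Matrix.trace_smul, smul_eq_mul]
  ring

theorem pairing_neg_left (X Y : Matrix (Fin 2) (Fin 2) ℂ) :
    pairing (-X) Y = -pairing X Y := by
  simp [pairing]

theorem pairing_neg_right (X Y : Matrix (Fin 2) (Fin 2) ℂ) :
    pairing X (-Y) = -pairing X Y := by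
  simp [pairing]

/-- Asymptotic coordinate lines and Gauss curvature −1 for the Sym immersion: the diagonal
coefficients `⟨ψₓₓ,N⟩` and `⟨ψ_yy,N⟩` of the second fundamental form vanish (the coordinate
lines are asymptotic lines), and the determinant of the second fundamental form equals minus
the determinant of the first fundamental form, so the Gaussian curvature equals `−1`
wherever `sin φ ≠ 0`. -/
theorem sym_gauss_curvature_minus_one
    (φ : ℝ → ℝ → ℝ) (hφ : ContDiff ℝ (⊤ : ℕ∞) (fun p : ℝ × ℝ => φ p.1 p.2))
    (hsg : ∀ x y : ℝ, deriv (fun x' => deriv (fun y' => φ x' y') y) x = Real.sin (φ x y))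
    (U : ℝ → ℝ → ℝ → Matrix (Fin 2) (Fin 2) ℂ)
    (hU : IsExtendedFrame φ U) :
    ∀ x y lam : ℝ, 0 < lam →
      pairing (deriv (fun x' => deriv (fun x'' => symMap U x'' y lam) x') x)
          (gaussN U x y lam) = 0 ∧
      pairing (deriv (fun y' => deriv (fun y'' => symMap U x y'' lam) y') y)
          (gaussN U x y lam) = 0 ∧
      pairing (deriv (fun x' => deriv (fun x'' => symMap U x'' y lam) x') x)
            (gaussN U x y lam) *
          pairing (deriv (fun y' => deriv (fun y'' => symMap U x y'' lam) y') y)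
            (gaussN U x y lam) -
          (pairing (deriv (fun y' => deriv (fun x' => symMap U x' y' lam) x) y)
            (gaussN U x y lam)) ^ 2
        = -(pairing (deriv (fun x' => symMap U x' y lam) x)
              (deriv (fun x' => symMap U x' y lam) x) *
            pairing (deriv (fun y' => symMap U x y' lam) y)
              (deriv (fun y' => symMap U x y' lam) y) -
            (pairing (deriv (fun x' => symMap U x' y lam) x)
              (deriv (fun y' => symMap U x y' lam) y)) ^ 2) := by
  intro x y lam hl
  have hl' : (lam : ℂ) ≠ 0 := by exact_mod_cast hl.ne'
  have hdet : ∀ x y, (U x y lam).det = 1 := fun x y => (hU.2.2.2 x y lam hl).2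
  have hφy : HasDerivAt (fun y => φ x y) (deriv (fun y => φ x y) y) y :=
    DifferentiableAt.hasDerivAt <| (hφ.differentiable (by simp) (x, y)).comp y
      (DifferentiableAt.prodMk (differentiableAt_const x) differentiableAt_id)
  have hx : ∀ x y, deriv (fun x => symMap U x y lam) x =
      (lam : ℂ) • (U x y lam * AphiDeriv * (U x y lam)⁻¹) := fun x y =>
    (hasDerivAt_symMap_fst hU x y hl).deriv
  have hy : ∀ x y, deriv (fun y => symMap U x y lam) y =
      -(U x y lam * Bphi φ lam x y * (U x y lam)⁻¹) := fun x y =>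
    (hasDerivAt_symMap_snd hU x y hl).deriv
  have hxx : deriv (fun x => (lam : ℂ) • (U x y lam * AphiDeriv * (U x y lam)⁻¹)) x =
      (lam : ℂ) • (U x y lam * (Aphi φ lam x y * AphiDeriv - AphiDeriv * Aphi φ lam x y + 0) *
        (U x y lam)⁻¹) := (HasDerivAt.fun_const_smul (lam : ℂ) (HasDerivAt.matrixConj (fun x => hdet x y)
    (hU.2.1 lam hl x y).1 (trace_Aphi φ lam x y) (hasDerivAt_const x AphiDeriv))).deriv
  have hyx : deriv (fun y => (lam : ℂ) • (U x y lam * AphiDeriv * (U x y lam)⁻¹)) y =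
      (lam : ℂ) • (U x y lam * (Bphi φ lam x y * AphiDeriv - AphiDeriv * Bphi φ lam x y + 0) *
        (U x y lam)⁻¹) := (HasDerivAt.fun_const_smul (lam : ℂ) (HasDerivAt.matrixConj (fun y => hdet x y)
    (hU.2.1 lam hl x y).2 (trace_Bphi φ lam x y) (hasDerivAt_const y AphiDeriv))).deriv
  have hyy : deriv (fun y => -(U x y lam * Bphi φ lam x y * (U x y lam)⁻¹)) y =
      -(U x y lam * (Bphi φ lam x y * Bphi φ lam x y - Bphi φ lam x y * Bphi φ lam x y +
        (Complex.I / 2) • (lam : ℂ)⁻¹ •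
          !![0, Complex.exp (-Complex.I * ((φ x y : ℝ) : ℂ)) *
              (-Complex.I * (deriv (fun y => φ x y) y : ℝ));
            Complex.exp (Complex.I * ((φ x y : ℝ) : ℂ)) *
              (Complex.I * (deriv (fun y => φ x y) y : ℝ)), 0]) *
        (U x y lam)⁻¹) := (HasDerivAt.matrixConj (fun y => hdet x y)
    (hU.2.1 lam hl x y).2 (trace_Bphi φ lam x y) (hasDerivAt_Bphi_snd lam hφy)).fun_neg.deriv
  simp only [hx, hy]
  have hxx0 : pairing (deriv (fun x => (lam : ℂ) • (U x y lam * AphiDeriv * (U x y lam)⁻¹)) x)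
      (gaussN U x y lam) = 0 := by
    rw [hxx, gaussN, pairing_smul_left, pairing_conj (hdet x y)]
    simp [pairing, Aphi, AphiDeriv, sigma3, Matrix.trace_fin_two]
  have hyy0 : pairing (deriv (fun y => -(U x y lam * Bphi φ lam x y * (U x y lam)⁻¹)) y)
      (gaussN U x y lam) = 0 := by
    rw [hyy, gaussN, pairing_neg_left, pairing_conj (hdet x y)]
    simp [pairing, Bphi, sigma3, Matrix.trace_fin_two]
  refine ⟨hxx0, hyy0, ?_⟩
  rw [hxx0, hyx, gaussN]
  simp only [pairing_smul_left, pairing_smul_right, pairing_neg_left, pairing_neg_right,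
    pairing_conj (hdet x y)]
  simp [pairing, Bphi, AphiDeriv, sigma3, Matrix.trace_fin_two]
  field_simp
  linear_combination -4 * (Complex.exp (Complex.I * (φ x y : ℂ)) -
    Complex.exp (-(Complex.I * (φ x y : ℂ)))) ^ 2 * Complex.I_sq

end
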